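/- arXiv:1903.05824 — 2 statements merged into one kernel-verified Lean document; each statement's English description precedes it below -/
import Mathlib

section
/- Let I be the homogeneous ideal of any finite set of s points in projective n-space over an algebraically closed field. Then for all positive integers m, α(I^{(m)}) ≤ ⌊s^{1/n}·(m+n-1)⌋ - n + 1, and consequently (α(I^{(m)}) + n - 1)/(m + n - 1) ≤ s^{1/n}. -/
open MvPolynomial in
/-- One point imposes at most `#{exponents of degree m-1}` conditions on forms of degree `d`. -/
lemma point_conditions {F : Type*} [Field F] {n : ℕ} (p : Fin (n + 1) → F) (hp : p ≠ 0)
    (m d : ℕ) (hm : 0 < m) (hd : m ≤ d) :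
    ∃ T : MvPolynomial (Fin (n + 1)) F →ₗ[F]
        ((Finset.finsuppAntidiag (Finset.univ : Finset (Fin (n + 1))) (m - 1)) → F),
      ∀ f : MvPolynomial (Fin (n + 1)) F, f.IsHomogeneous d → T f = 0 →
        f ∈ (RingHom.ker (MvPolynomial.eval p)) ^ m := by
  obtain ⟨k, hk⟩ : ∃ k, p k ≠ 0 := by
    by_contra h
    push Not at h
    exact hp (funext h)
  let g : Fin (n + 1) → MvPolynomial (Fin (n + 1)) F :=
    fun j => if j = k then X k else X j + C (p j / p k) * X k
  let h : Fin (n + 1) → MvPolynomial (Fin (n + 1)) F :=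
    fun j => if j = k then X k else X j - C (p j / p k) * X k
  have hgh : ∀ f, aeval h (aeval g f) = f := by
    intro f
    have : (aeval h).comp (aeval g) = AlgHom.id F (MvPolynomial (Fin (n + 1)) F) := by
      apply MvPolynomial.algHom_ext
      intro j
      by_cases hj : j = k
      · simp [g, h, hj]
      · simp [g, h, hj, algebraMap_eq]
    exact DFunLike.congr_fun this f
  have hg : ∀ j, (g j).IsHomogeneous 1 := by
    intro j
    by_cases hj : j = k
    · simp only [g, hj, if_true]; exact isHomogeneous_X _ _
    · simp only [g, hj, if_false]
      refine (isHomogeneous_X _ _).add ?_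
      simpa using (isHomogeneous_C _ _).mul (isHomogeneous_X _ _)
  have hh : ∀ j, j ≠ k → h j ∈ RingHom.ker (MvPolynomial.eval p) := by
    intro j hj
    simp only [h, hj, if_false, RingHom.mem_ker]
    simp [hk]
  refine ⟨LinearMap.pi (fun e => (lcoeff F (e.1 + Finsupp.single k (d - m + 1))).comp
    (aeval g).toLinearMap), ?_⟩
  intro f hf hT
  rw [← hgh f, (aeval g f).as_sum, map_sum]
  refine Ideal.sum_mem _ ?_
  intro e he
  have hhom : (aeval g f).IsHomogeneous d := by simpa using hf.aeval g hg
  have hdeg : e.degree = d := by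
    by_contra hne
    exact (mem_support_iff.1 he) (hhom.coeff_eq_zero hne)
  have hsum : ∑ j, e j = d := by rw [← hdeg, Finsupp.degree_eq_sum]
  have hek : e k ≤ d - m := by
    by_contra hlt
    push Not at hlt
    have hle : Finsupp.single k (d - m + 1) ≤ e := by
      rw [Finsupp.single_le_iff]; omega
    have hadd : (e - Finsupp.single k (d - m + 1)) + Finsupp.single k (d - m + 1) = e :=
      tsub_add_cancel_of_le hle
    have hd2 : (e - Finsupp.single k (d - m + 1)).degree + (d - m + 1) = d := by
      have := congrArg Finsupp.degree hadd
      rw [map_add, Finsupp.degree_single, hdeg] at this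
      exact this
    have hmem : (e - Finsupp.single k (d - m + 1)) ∈
        Finset.finsuppAntidiag (Finset.univ : Finset (Fin (n + 1))) (m - 1) := by
      rw [Finset.mem_finsuppAntidiag]
      refine ⟨?_, Finset.subset_univ _⟩
      rw [← Finsupp.degree_eq_sum]; omega
    have := congrFun hT ⟨_, hmem⟩
    simp only [LinearMap.pi_apply, LinearMap.comp_apply, hadd, lcoeff_apply] at this
    exact (mem_support_iff.1 he) this
  rw [aeval_monomial]
  refine Ideal.mul_mem_left _ _ ?_
  rw [Finsupp.prod_fintype _ _ (by simp),
    ← Finset.mul_prod_erase Finset.univ _ (Finset.mem_univ k)]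
  refine Ideal.mul_mem_left _ _ ?_
  have h1 : ∏ j ∈ Finset.univ.erase k, h j ^ e j ∈
      ∏ j ∈ Finset.univ.erase k, (RingHom.ker (MvPolynomial.eval p)) ^ e j :=
    Ideal.prod_mem_prod (fun j hj => Ideal.pow_mem_pow (hh j (Finset.ne_of_mem_erase hj)) _)
  rw [Finset.prod_pow_eq_pow_sum] at h1
  refine Ideal.pow_le_pow_right ?_ h1
  have := Finset.add_sum_erase Finset.univ (fun j => e j) (Finset.mem_univ k)
  simp only [hsum] at this
  omega

open MvPolynomial in
lemma exists_form {F : Type*} [Field F] {n s : ℕ} (p : Fin s → (Fin (n + 1) → F))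
    (hp : ∀ i, p i ≠ 0) (m d : ℕ) (hm : 0 < m) (hd : m ≤ d)
    (hc : s * (m - 1 + n).choose n < (d + n).choose n) :
    ∃ f : MvPolynomial (Fin (n + 1)) F,
      f ≠ 0 ∧ f.IsHomogeneous d ∧ ∀ i, f ∈ (RingHom.ker (MvPolynomial.eval (p i))) ^ m := by
  choose T hT using fun i => point_conditions (p i) (hp i) m d hm hd
  let A := Finset.finsuppAntidiag (Finset.univ : Finset (Fin (n + 1))) d
  let P : (A → F) →ₗ[F] MvPolynomial (Fin (n + 1)) F :=
    ∑ a : A, (MvPolynomial.monomial a.1).comp (LinearMap.proj a)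
  have hP : ∀ c, P c = ∑ a : A, MvPolynomial.monomial a.1 (c a) := by
    intro c; simp [P, LinearMap.sum_apply]
  have hcard : ∀ t, (Finset.finsuppAntidiag (Finset.univ : Finset (Fin (n + 1))) t).card
      = (t + n).choose n := by
    intro t
    rw [Finset.card_finsuppAntidiag_nat_eq_choose]
    simp only [Finset.card_univ, Fintype.card_fin]
    rw [show n + 1 + t - 1 = t + n by omega, ← Nat.choose_symm_add]
  let L := (LinearMap.pi T).comp P
  have hker : LinearMap.ker L ≠ ⊥ := by
    apply LinearMap.ker_ne_bot_of_finrank_lt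
    rw [Module.finrank_pi_fintype]
    simp only [Module.finrank_fintype_fun_eq_card, Fintype.card_coe, hcard, A, Finset.sum_const,
      Finset.card_univ, Fintype.card_fin, smul_eq_mul]
    exact hc
  obtain ⟨c, hcL, hc0⟩ := (Submodule.ne_bot_iff _).1 hker
  have hhom : (P c).IsHomogeneous d := by
    rw [hP]
    apply IsHomogeneous.sum
    intro a _
    apply isHomogeneous_monomial
    rw [Finsupp.degree_eq_sum]
    exact (Finset.mem_finsuppAntidiag.1 a.2).1
  refine ⟨P c, ?_, hhom, ?_⟩
  · intro h0
    apply hc0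
    funext b
    have := congrArg (coeff b.1) h0
    rw [hP, coeff_sum, Finset.sum_eq_single b] at this
    · simpa using this
    · intro a _ hab
      rw [coeff_monomial, if_neg (fun h => hab (Subtype.ext h))]
    · simp
  · intro i
    exact hT i _ hhom (congrFun (LinearMap.mem_ker.1 hcL) i)

lemma count_ineq (n s m d : ℕ) (hn : 0 < n) (hm : 0 < m) (r : ℝ) (hr : 1 ≤ r)
    (hrs : r ^ n = s) (h : r * ((m : ℝ) + n - 1) < d + n) :
    s * (m - 1 + n).choose n < (d + n).choose n := by
  have key : (s : ℝ) * (m.ascFactorial n : ℝ) < ((d + 1).ascFactorial n : ℝ) := by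
    rw [Nat.ascFactorial_eq_prod_range, Nat.ascFactorial_eq_prod_range]
    push_cast
    have : (s : ℝ) * ∏ i ∈ Finset.range n, ((m : ℝ) + i)
        = ∏ i ∈ Finset.range n, (r * ((m : ℝ) + i)) := by
      rw [Finset.prod_mul_distrib]; simp [hrs]
    rw [this]
    have hm' : (0 : ℝ) < m := by exact_mod_cast hm
    apply Finset.prod_lt_prod_of_nonempty
    · intro i _
      positivity
    · intro i hi
      have : ((i : ℝ) + 1) ≤ n := by exact_mod_cast Finset.mem_range.1 hi
      nlinarith
    · simpa using hn.ne'
  have key2 : s * m.ascFactorial n < (d + 1).ascFactorial n := by exact_mod_cast key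
  rw [Nat.ascFactorial_eq_factorial_mul_choose, Nat.ascFactorial_eq_factorial_mul_choose',
    mul_left_comm, show m + n - 1 = m - 1 + n by omega] at key2
  exact lt_of_mul_lt_mul_left key2 (Nat.zero_le _)


/-- For the homogeneous ideal of `s` points of projective `n`-space over an algebraically
closed field (points given by nonzero representative vectors), the least degree `α` of a
nonzero homogeneous polynomial vanishing to order `≥ m` at each point satisfies
`α ≤ ⌊s^{1/n}(m+n-1)⌋ - n + 1`, hence `(α + n - 1)/(m + n - 1) ≤ s^{1/n}`. -/
theorem stmt_13 (F : Type*) [Field F] [IsAlgClosed F] (n s : ℕ) (hn : 0 < n) (hs : 0 < s)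
    (p : Fin s → (Fin (n + 1) → F)) (hp : ∀ i, p i ≠ 0) (m : ℕ) (hm : 0 < m) :
    let α : ℕ := sInf {d : ℕ | ∃ f : MvPolynomial (Fin (n + 1)) F,
      f ≠ 0 ∧ f.IsHomogeneous d ∧ ∀ i, f ∈ (RingHom.ker (MvPolynomial.eval (p i))) ^ m}
    (α : ℝ) ≤ (⌊(s : ℝ) ^ ((n : ℝ)⁻¹) * ((m : ℝ) + n - 1)⌋ : ℝ) - n + 1 ∧
    ((α : ℝ) + n - 1) / ((m : ℝ) + n - 1) ≤ (s : ℝ) ^ ((n : ℝ)⁻¹) := by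
  intro α
  set r : ℝ := (s : ℝ) ^ ((n : ℝ)⁻¹) with hrdef
  have hs1 : (1 : ℝ) ≤ s := by exact_mod_cast hs
  have hm1 : (1 : ℝ) ≤ m := by exact_mod_cast hm
  have hn1 : (1 : ℝ) ≤ n := by exact_mod_cast hn
  have hr : 1 ≤ r := Real.one_le_rpow hs1 (by positivity)
  have hrs : r ^ n = s := Real.rpow_inv_natCast_pow (by positivity) hn.ne'
  set N : ℤ := ⌊r * ((m : ℝ) + n - 1)⌋ with hN
  have hNle : (N : ℝ) ≤ r * ((m : ℝ) + n - 1) := Int.floor_le _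
  have hNlt : r * ((m : ℝ) + n - 1) < N + 1 := Int.lt_floor_add_one _
  have hNge : (m : ℤ) + n - 1 ≤ N := by
    apply Int.le_floor.2
    push_cast
    nlinarith
  obtain ⟨d, hd⟩ : ∃ d : ℕ, (d : ℤ) = N - n + 1 := ⟨(N - n + 1).toNat, by omega⟩
  have hdR : (d : ℝ) = N - n + 1 := by exact_mod_cast hd
  have hα : α ≤ d := Nat.sInf_le (exists_form p hp m d hm (by omega)
    (count_ineq n s m d hn hm r hr hrs (by linarith)))
  have hαR : (α : ℝ) ≤ d := by exact_mod_cast hα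
  refine ⟨by linarith, ?_⟩
  rw [div_le_iff₀ (by linarith)]
  linarith
end

section
/- Let I be the homogeneous ideal of any finite set of s points in projective n-space over an algebraically closed field, with n ≥ 2. Let k = ⌊s^{1/n}⌋ and let ε be the fractional part of s^{1/n}. If k - 2 ≥ (2ε/(n-1))·(m-1) for a positive integer m, then α(I^{(m)}) ≤ k(m+n-1) - n + 1, and hence (α(I^{(m)}) + n - 1)/(m + n - 1) ≤ k. -/
open MvPolynomial in
lemma aux_mem {F : Type*} [Field F] {N : ℕ} (p : Fin N → F) (j : Fin N) (hj : p j ≠ 0)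
    (m d : ℕ) (f : MvPolynomial (Fin N) F) (hf : f.IsHomogeneous d)
    (hc : ∀ a : Fin N →₀ ℕ, a.degree = d → ∑ i ∈ Finset.univ.erase j, a i < m →
      coeff a (aeval (fun i => if i = j then C (p j) * X j
        else (X i + C (p i) * X j : MvPolynomial (Fin N) F)) f) = 0) :
    f ∈ (RingHom.ker (MvPolynomial.eval p)) ^ m := by
  set g : Fin N → MvPolynomial (Fin N) F := fun i => if i = j then C (p j) * X j
        else (X i + C (p i) * X j : MvPolynomial (Fin N) F) with hg
  set h : Fin N → MvPolynomial (Fin N) F := fun i => if i = j then C (p j)⁻¹ * X j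
        else (X i - C (p i * (p j)⁻¹) * X j : MvPolynomial (Fin N) F) with hh
  have hcomp : aeval h (aeval g f) = f := by
    have : (aeval h).comp (aeval g) = AlgHom.id F (MvPolynomial (Fin N) F) := by
      apply MvPolynomial.algHom_ext
      intro i
      by_cases hi : i = j
      · subst hi
        simp only [AlgHom.comp_apply, aeval_X, hg, hh, if_true, map_mul, AlgHom.id_apply,
          algHom_C, algebraMap_eq]
        rw [← mul_assoc, ← C_mul, mul_inv_cancel₀ hj, C_1, one_mul]
      · simp only [AlgHom.comp_apply, aeval_X, hg, hh, if_true, if_neg hi, map_mul, map_add,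
          AlgHom.id_apply, algHom_C, algebraMap_eq]
        ring
    exact DFunLike.congr_fun this f
  have hghom : (aeval g f).IsHomogeneous d := by
    have := hf.aeval (n := 1) g (by
      intro i
      simp only [hg]
      split_ifs
      · simpa using (isHomogeneous_C (Fin N) (p j)).mul (isHomogeneous_X F j)
      · exact (isHomogeneous_X F i).add
          (by simpa using (isHomogeneous_C (Fin N) (p i)).mul (isHomogeneous_X F j)))
    simpa using this
  rw [← hcomp, (aeval g f).as_sum, map_sum]
  refine Ideal.sum_mem _ fun a ha => ?_
  rw [mem_support_iff] at ha
  have hdeg : a.degree = d := by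
    by_contra hne
    exact ha (hghom.coeff_eq_zero hne)
  have hm : m ≤ ∑ i ∈ Finset.univ.erase j, a i := by
    by_contra hlt
    exact ha (hc a hdeg (not_le.mp hlt))
  rw [aeval_monomial, Finsupp.prod_fintype _ _ (by simp),
    ← Finset.prod_erase_mul _ _ (Finset.mem_univ j)]
  refine Ideal.mul_mem_left _ _ (Ideal.mul_mem_right _ _ ?_)
  apply Ideal.pow_le_pow_right hm
  rw [← Finset.prod_pow_eq_pow_sum]
  refine Ideal.prod_mem_prod fun i hi => Ideal.pow_mem_pow ?_ _
  have hi' : i ≠ j := (Finset.mem_erase.mp hi).1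
  rw [RingHom.mem_ker]
  simp only [hh, if_neg hi', map_sub, map_mul, eval_X, eval_C]
  rw [mul_assoc, inv_mul_cancel₀ hj]
  ring

open MvPolynomial in
lemma aux_exists {F : Type*} [Field F] {N s : ℕ} (p : Fin s → (Fin N → F)) (hp : ∀ i, p i ≠ 0)
    (m d : ℕ) (hm : 0 < m)
    (hcard : s * ((Finset.univ : Finset (Fin N)).finsuppAntidiag (m - 1)).card
      < ((Finset.univ : Finset (Fin N)).finsuppAntidiag d).card) :
    ∃ f : MvPolynomial (Fin N) F,
      f ≠ 0 ∧ f.IsHomogeneous d ∧ ∀ i, f ∈ (RingHom.ker (MvPolynomial.eval (p i))) ^ m := by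
  have hp' : ∀ i, ∃ j, p i j ≠ 0 := fun i => Function.ne_iff.mp (hp i)
  choose j hj using hp'
  let A : ℕ → Type := fun D => ↥((Finset.univ : Finset (Fin N)).finsuppAntidiag D)
  let P : (A d → F) →ₗ[F] MvPolynomial (Fin N) F :=
    ∑ a : A d, (monomial (R := F) a.1).comp (LinearMap.proj a)
  have hP : ∀ c, P c = ∑ a : A d, monomial a.1 (c a) := by
    intro c; simp [P]
  have hmemA : ∀ (D : ℕ) (a : Fin N →₀ ℕ),
      a ∈ (Finset.univ : Finset (Fin N)).finsuppAntidiag D ↔ a.degree = D := by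
    intro D a
    simp [Finset.mem_finsuppAntidiag, Finsupp.degree_eq_sum]
  let G : Fin s → (MvPolynomial (Fin N) F →ₐ[F] MvPolynomial (Fin N) F) := fun i =>
    aeval (fun l => if l = j i then C (p i (j i)) * X (j i)
        else (X l + C (p i l) * X (j i) : MvPolynomial (Fin N) F))
  let e : Fin s → (Fin N →₀ ℕ) → (Fin N →₀ ℕ) := fun i b =>
    b.update (j i) (d - ∑ l ∈ Finset.univ.erase (j i), b l)
  let L : (A d → F) →ₗ[F] (Fin s × A (m - 1) → F) :=
    LinearMap.pi fun q => (lcoeff F (e q.1 q.2.1)).comp ((G q.1).toLinearMap.comp P)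
  have hL : ∀ c q, L c q = coeff (e q.1 q.2.1) (G q.1 (P c)) := by
    intro c q; rfl
  have hker : LinearMap.ker L ≠ ⊥ := by
    apply LinearMap.ker_ne_bot_of_finrank_lt
    simpa [A] using hcard
  obtain ⟨c, hc, hc0⟩ := Submodule.exists_mem_ne_zero_of_ne_bot hker
  rw [LinearMap.mem_ker] at hc
  have hhom : (P c).IsHomogeneous d := by
    rw [hP]
    exact IsHomogeneous.sum _ _ _ fun a _ => isHomogeneous_monomial _ ((hmemA d _).1 a.2)
  refine ⟨P c, ?_, hhom, fun i => ?_⟩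
  · intro h0
    apply hc0
    funext a
    have := congrArg (coeff a.1) h0
    rw [hP, coeff_sum] at this
    simp only [coeff_monomial, coeff_zero] at this
    rw [Finset.sum_eq_single a (fun b _ hb => if_neg (fun h => hb (Subtype.ext h)))
      (fun h => absurd (Finset.mem_univ a) h), if_pos rfl] at this
    exact this
  · refine aux_mem (p i) (j i) (hj i) m d _ hhom fun a ha hlt => ?_
    set b : Fin N →₀ ℕ :=
      a.update (j i) (m - 1 - ∑ l ∈ Finset.univ.erase (j i), a l) with hb
    have hsum : ∀ l ∈ Finset.univ.erase (j i), b l = a l := by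
      intro l hl
      simp [hb, Finsupp.update_apply, (Finset.mem_erase.mp hl).1]
    have hS : ∑ l ∈ Finset.univ.erase (j i), b l = ∑ l ∈ Finset.univ.erase (j i), a l :=
      Finset.sum_congr rfl hsum
    have hbj : b (j i) = m - 1 - ∑ l ∈ Finset.univ.erase (j i), a l := by
      simp [hb]
    have hbm : b.degree = m - 1 := by
      rw [Finsupp.degree_eq_sum, ← Finset.sum_erase_add _ _ (Finset.mem_univ (j i)),
        hS, hbj]
      omega
    have hab : e i b = a := by
      ext l
      by_cases hl : l = j i
      · subst hl
        rw [Finsupp.degree_eq_sum, ← Finset.sum_erase_add _ _ (Finset.mem_univ (j i))] at ha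
        simp only [e, Finsupp.update_apply, if_true]
        rw [hS]
        omega
      · simp [e, Finsupp.update_apply, hl, hb]
    have := congrFun hc (i, ⟨b, (hmemA _ _).2 hbm⟩)
    rw [hL] at this
    simp only [hab] at this
    exact this

/-- The pairing inequality. -/
lemma aux_num (n : ℕ) (hn : 2 ≤ n) (k m c : ℝ) (hk : 2 ≤ k) (hm : 1 ≤ m) (hc : k ≤ c)
    (hck : c < k + 1) (h : 2 * (c - k) * (m - 1) ≤ (k - 2) * (n - 1)) :
    c ^ n * ∏ i ∈ Finset.range n, (m + n - 1 - i)
      < ∏ i ∈ Finset.range n, (k * (m + n - 1) + 1 - i) := by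
  have hn' : (2 : ℝ) ≤ n := by exact_mod_cast hn
  have hkM : m + n - 1 ≤ k * (m + n - 1) := by nlinarith
  have hi : ∀ i ∈ Finset.range n, (i : ℝ) ≤ n - 1 := by
    intro i hi
    have : i + 1 ≤ n := Finset.mem_range.mp hi
    have : (i : ℝ) + 1 ≤ n := by exact_mod_cast this
    linarith
  have hr : ∀ i ∈ Finset.range n, ((n - 1 - i : ℕ) : ℝ) = n - 1 - i := by
    intro i hi
    have : i + 1 ≤ n := Finset.mem_range.mp hi
    rw [Nat.sub_sub, Nat.cast_sub (by omega)]
    push_cast; ring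
  apply lt_of_pow_lt_pow_left₀ 2 (Finset.prod_nonneg fun i hi' => by have := hi i hi'; linarith)
  have h1 : ∏ i ∈ Finset.range n, (m + n - 1 - (n - 1 - i) : ℝ)
      = ∏ i ∈ Finset.range n, (m + n - 1 - i : ℝ) := by
    rw [← Finset.prod_range_reflect (fun i : ℕ => (m + n - 1 - i : ℝ)) n]
    exact Finset.prod_congr rfl fun i hi' => by rw [hr i hi']
  have h2 : ∏ i ∈ Finset.range n, (k * (m + n - 1) + 1 - (n - 1 - i) : ℝ)
      = ∏ i ∈ Finset.range n, (k * (m + n - 1) + 1 - i : ℝ) := by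
    rw [← Finset.prod_range_reflect (fun i : ℕ => (k * (m + n - 1) + 1 - i : ℝ)) n]
    exact Finset.prod_congr rfl fun i hi' => by rw [hr i hi']
  have e1 : (c ^ n * ∏ i ∈ Finset.range n, (m + n - 1 - i)) ^ 2 =
      ∏ i ∈ Finset.range n, (c ^ 2 * ((m + n - 1 - i) * (m + n - 1 - (n - 1 - i)))) := by
    rw [Finset.prod_mul_distrib, Finset.prod_mul_distrib, Finset.prod_const, Finset.card_range]
    rw [h1]
    ring
  have e2 : (∏ i ∈ Finset.range n, (k * (m + n - 1) + 1 - i)) ^ 2 =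
      ∏ i ∈ Finset.range n,
        ((k * (m + n - 1) + 1 - i) * (k * (m + n - 1) + 1 - (n - 1 - i))) := by
    rw [Finset.prod_mul_distrib]
    rw [h2]
    ring
  rw [e1, e2]
  have hxy : c * (m + (n - 1) / 2) < k * (m + n - 1) + 1 - (n - 1) / 2 := by
    nlinarith
  have hy : 0 ≤ c * (m + (n - 1) / 2) := by
    apply mul_nonneg <;> linarith
  have hsq : (c * (m + (n - 1) / 2)) ^ 2 < (k * (m + n - 1) + 1 - (n - 1) / 2) ^ 2 :=
    pow_lt_pow_left₀ hxy hy (by norm_num)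
  have hc1 : 1 ≤ c ^ 2 := by nlinarith
  apply Finset.prod_lt_prod_of_nonempty
  · intro i hi'
    have := hi i hi'
    have h0 : (0 : ℝ) ≤ i := Nat.cast_nonneg i
    have : 0 < c := by linarith
    apply mul_pos (by positivity)
    apply mul_pos <;> linarith
  · intro i hi'
    nlinarith [mul_nonneg (sub_nonneg.mpr hc1) (sq_nonneg ((i : ℝ) - (n - 1) / 2))]
  · exact ⟨0, Finset.mem_range.mpr (by omega)⟩


/-- For the homogeneous ideal of `s` points of projective `n`-space (`n ≥ 2`) over an
algebraically closed field, with `k = ⌊s^{1/n}⌋` and `ε` the fractional part of `s^{1/n}`: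
if `k - 2 ≥ (2ε/(n-1))(m-1)` then the least degree `α` of a nonzero homogeneous polynomial
vanishing to order `≥ m` at each point satisfies `α ≤ k(m+n-1) - n + 1`, hence
`(α + n - 1)/(m + n - 1) ≤ k`. -/
theorem stmt_14 (F : Type*) [Field F] [IsAlgClosed F] (n s : ℕ) (hn : 2 ≤ n) (hs : 0 < s)
    (p : Fin s → (Fin (n + 1) → F)) (hp : ∀ i, p i ≠ 0) (m : ℕ) (hm : 0 < m) :
    let k : ℕ := ⌊(s : ℝ) ^ ((n : ℝ)⁻¹)⌋₊
    let ε : ℝ := (s : ℝ) ^ ((n : ℝ)⁻¹) - k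
    let α : ℕ := sInf {d : ℕ | ∃ f : MvPolynomial (Fin (n + 1)) F,
      f ≠ 0 ∧ f.IsHomogeneous d ∧ ∀ i, f ∈ (RingHom.ker (MvPolynomial.eval (p i))) ^ m}
    (k : ℝ) - 2 ≥ (2 * ε / ((n : ℝ) - 1)) * ((m : ℝ) - 1) →
      (α : ℝ) ≤ (k : ℝ) * ((m : ℝ) + n - 1) - n + 1 ∧
      ((α : ℝ) + n - 1) / ((m : ℝ) + n - 1) ≤ (k : ℝ) := by
  intro k ε α hyp
  have hn' : (2 : ℝ) ≤ n := by exact_mod_cast hn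
  have hm' : (1 : ℝ) ≤ m := by exact_mod_cast hm
  set c : ℝ := (s : ℝ) ^ ((n : ℝ)⁻¹) with hcdef
  have hc0 : 0 ≤ c := Real.rpow_nonneg (Nat.cast_nonneg s) _
  have hcn : c ^ n = s := Real.rpow_inv_natCast_pow (Nat.cast_nonneg s) (by omega)
  have hkc : (k : ℝ) ≤ c := Nat.floor_le hc0
  have hck : c < k + 1 := Nat.lt_floor_add_one c
  have hε : ε = c - k := rfl
  have hε0 : 0 ≤ ε := by rw [hε]; linarith
  have hk2 : (2 : ℝ) ≤ k := by
    have : 0 ≤ (2 * ε / ((n : ℝ) - 1)) * ((m : ℝ) - 1) :=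
      mul_nonneg (div_nonneg (by linarith) (by linarith)) (by linarith)
    linarith
  have hk2' : 2 ≤ k := by exact_mod_cast hk2
  have hyp' : 2 * (c - k) * ((m : ℝ) - 1) ≤ (k - 2) * (n - 1) := by
    have hpos : (0 : ℝ) < n - 1 := by linarith
    have h1 := mul_le_mul_of_nonneg_right hyp hpos.le
    have h2 : (2 * ε / ((n : ℝ) - 1)) * ((m : ℝ) - 1) * (n - 1) = 2 * ε * (m - 1) := by
      field_simp
    rw [h2, hε] at h1
    exact h1
  have key := aux_num n hn k m c hk2 hm' hkc hck hyp'
  rw [hcn] at key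
  obtain ⟨d, hd⟩ : ∃ d, d + (n - 1) = k * (m + n - 1) := by
    refine ⟨k * (m + n - 1) - (n - 1), Nat.sub_add_cancel ?_⟩
    calc n - 1 ≤ 1 * (m + n - 1) := by omega
      _ ≤ k * (m + n - 1) := Nat.mul_le_mul_right _ (by omega)
  have hM : ((m + n - 1 : ℕ) : ℝ) = m + n - 1 := by
    rw [Nat.cast_sub (by omega)]; push_cast; ring
  have hdn : d + n = k * (m + n - 1) + 1 := by omega
  have hdnR : (d : ℝ) + n = k * (m + n - 1) + 1 := by
    rw [← hM]; exact_mod_cast hdn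
  have hdesc : s * (m + n - 1).descFactorial n < (d + n).descFactorial n := by
    rw [Nat.descFactorial_eq_prod_range, Nat.descFactorial_eq_prod_range]
    have e1 : ((∏ i ∈ Finset.range n, (m + n - 1 - i) : ℕ) : ℝ)
        = ∏ i ∈ Finset.range n, ((m : ℝ) + n - 1 - i) := by
      rw [Nat.cast_prod]
      refine Finset.prod_congr rfl fun i hi => ?_
      have := Finset.mem_range.mp hi
      rw [Nat.cast_sub (by omega), hM]
    have e2 : ((∏ i ∈ Finset.range n, (d + n - i) : ℕ) : ℝ)
        = ∏ i ∈ Finset.range n, ((k : ℝ) * (m + n - 1) + 1 - i) := by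
      rw [Nat.cast_prod]
      refine Finset.prod_congr rfl fun i hi => ?_
      have := Finset.mem_range.mp hi
      rw [Nat.cast_sub (by omega), Nat.cast_add, hdnR]
    rw [← e1, ← e2] at key
    exact_mod_cast key
  have hchoose : s * (m + n - 1).choose n < (d + n).choose n := by
    rw [Nat.descFactorial_eq_factorial_mul_choose, Nat.descFactorial_eq_factorial_mul_choose] at hdesc
    have : n.factorial * (s * (m + n - 1).choose n) < n.factorial * (d + n).choose n := by
      calc _ = s * (n.factorial * (m + n - 1).choose n) := by ring
        _ < _ := hdesc
    exact Nat.lt_of_mul_lt_mul_left this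
  have hcardD : ∀ D : ℕ, ((Finset.univ : Finset (Fin (n + 1))).finsuppAntidiag D).card
      = (D + n).choose n := by
    intro D
    rw [Finset.card_finsuppAntidiag_nat_eq_choose, Finset.card_univ, Fintype.card_fin,
      show n + 1 + D - 1 = D + n by omega]
    exact Nat.choose_symm_add
  have hα : α ≤ d := by
    apply Nat.sInf_le
    apply aux_exists p hp m d hm
    rw [hcardD, hcardD, show m - 1 + n = m + n - 1 by omega]
    exact hchoose
  have hαR : (α : ℝ) ≤ d := by exact_mod_cast hα
  have hfin : (α : ℝ) ≤ (k : ℝ) * ((m : ℝ) + n - 1) - n + 1 := by linarith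
  refine ⟨hfin, ?_⟩
  rw [div_le_iff₀ (by linarith)]
  linarith
end
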